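/- Fix n ≥ 1. For every k ≥ 1 there exists a finite set B ⊆ ℚⁿ with |B| = n·k such that the number of distinct subsets of B of the form {b ∈ B : for all i < n, a_i < b_i}, as a = (a_0, …, a_{n−1}) ranges over ℚⁿ, is at least (k+1)ⁿ. (Hence the family of open lower orthants in ℚⁿ, equivalently the formula ⋀_{i<n} x <_i y_i in Th(ℚⁿ; <_0, …, <_{n−1}) where (x_0,…,x_{n−1}) <_i (y_0,…,y_{n−1}) iff x_i < y_i, has VC-density at least n.) -/

import Mathlib

theorem pt_inj (n k : ℕ) : Function.Injective
    (fun p : Fin n × Fin k => (Function.update (fun _ => (k:ℚ)) p.1 ((p.2 : ℕ) : ℚ) : Fin n → ℚ)) := by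
  rintro ⟨i, j⟩ ⟨i', j'⟩ h
  have h1 := congrFun h i
  simp only [Function.update_self] at h1
  by_cases hi : i = i'
  · subst hi
    simp only [Function.update_self, Nat.cast_inj] at h1
    rw [Fin.ext h1]
  · rw [Function.update_of_ne hi, Nat.cast_inj] at h1
    have := j.2
    omega

theorem half_lt (m j : ℕ) : ((m:ℚ) - 1/2 < j) ↔ m ≤ j := by
  constructor
  · intro h
    by_contra hc
    have : ((j:ℚ) + 1 ≤ m) := by exact_mod_cast (by omega : j + 1 ≤ m)
    linarith
  · intro h
    have : (m:ℚ) ≤ j := by exact_mod_cast h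
    linarith

theorem pt_mem (n k : ℕ) (m : Fin n → Fin (k+1)) (i : Fin n) (j : ℕ) :
    (∀ l, (((m l : ℕ) : ℚ) - 1/2) < (Function.update (fun _ => (k:ℚ)) i (j : ℚ) : Fin n → ℚ) l)
      ↔ (m i : ℕ) ≤ j := by
  constructor
  · intro h
    have := h i
    rwa [Function.update_self, half_lt] at this
  · intro h l
    by_cases hl : l = i
    · subst hl
      rwa [Function.update_self, half_lt]
    · rw [Function.update_of_ne hl, half_lt]
      have := (m l).2
      omega

theorem stmt_12 (n : ℕ) (hn : 1 ≤ n) :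
    ∀ k : ℕ, 1 ≤ k → ∃ B : Finset (Fin n → ℚ), B.card = n * k ∧
      (k + 1) ^ n ≤ Set.ncard
        {S : Set (Fin n → ℚ) | ∃ a : Fin n → ℚ,
          S = {b : Fin n → ℚ | b ∈ B ∧ ∀ i, a i < b i}} := by
  intro k hk
  refine ⟨Finset.univ.map ⟨_, pt_inj n k⟩, by simp, ?_⟩
  set B : Finset (Fin n → ℚ) := Finset.univ.map ⟨_, pt_inj n k⟩ with hB
  let F : (Fin n → Fin (k+1)) → Set (Fin n → ℚ) := fun m =>
    {b | b ∈ B ∧ ∀ i, (((m i : ℕ) : ℚ) - 1/2) < b i}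
  have key : ∀ m m', F m = F m' → ∀ i, (m' i : ℕ) ≤ m i := by
    intro m m' h i
    by_contra hc
    have hlt : (m i : ℕ) < k := by have := (m' i).2; omega
    have h1 : (Function.update (fun _ => (k:ℚ)) i ((m i : ℕ) : ℚ) : Fin n → ℚ) ∈ F m := by
      refine ⟨?_, (pt_mem n k m i _).2 le_rfl⟩
      rw [hB, Finset.mem_map]
      exact ⟨(i, ⟨m i, hlt⟩), Finset.mem_univ _, rfl⟩
    rw [h] at h1
    exact hc ((pt_mem n k m' i _).1 h1.2)
  have hF : Function.Injective F := fun m m' h =>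
    funext fun i => Fin.ext (le_antisymm (key _ _ h.symm i) (key _ _ h i))
  have hc : (Set.range F).ncard = (k+1)^n := by
    rw [← Set.image_univ, Set.ncard_image_of_injective _ hF, Set.ncard_univ]
    simp
  rw [← hc]
  apply Set.ncard_le_ncard
  · rintro _ ⟨m, rfl⟩
    exact ⟨_, rfl⟩
  · apply (B.finite_toSet.finite_subsets).subset
    rintro _ ⟨a, rfl⟩ b hb
    exact hb.1
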